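/- Let F be a field, c ∈ F, r a positive integer, and let (u_I)_{I⊆[r]} and (v_I)_{I⊆[r]} be two families of nonzero rational functions in F(q) with u_∅ = v_∅ = 1, each having the small cumulant property at q = c, i.e. for every subset H ⊆ [r] with |H| ≥ 2 one has κ_H(u)/(∏_{h∈H} u_{{h}}) = O_c((q−c)^{|H|−1}) and κ_H(v)/(∏_{h∈H} v_{{h}}) = O_c((q−c)^{|H|−1}). Then the entry-wise product family (u_I·v_I)_{I⊆[r]} and the entry-wise quotient family (u_I/v_I)_{I⊆[r]} also have the small cumulant property at q = c. -/

import Mathlib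

/-- The set of all set partitions of a finite set `s` into nonempty blocks. -/
def partitionsOf {α : Type*} [DecidableEq α] (s : Finset α) : Finset (Finset (Finset α)) :=
  s.powerset.powerset.filter
    (fun π => (∀ B ∈ π, B ≠ ∅) ∧ (∀ B ∈ π, ∀ B' ∈ π, B ≠ B' → B ∩ B' = ∅) ∧
      π.sup id = s)

/-- The partial cumulant `κ_H(u) = Σ_{π ∈ P(H)} (−1)^{#π−1}(#π−1)! ∏_{B∈π} u_B`. -/
def cumulant {α K : Type*} [DecidableEq α] [CommRing K] (u : Finset α → K)
    (H : Finset α) : K :=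
  ∑ π ∈ partitionsOf H,
    ((-1 : ℤ) ^ (π.card - 1) * (π.card - 1).factorial) • ∏ B ∈ π, u B

/-- `f = O_c(g)`: the rational function `f/g` has no pole at `q = c`. -/
def IsOAt {F : Type*} [Field F] (c : F) (f g : RatFunc F) : Prop :=
  ∃ a b : Polynomial F, Polynomial.eval c b ≠ 0 ∧
    f * algebraMap (Polynomial F) (RatFunc F) b =
      g * algebraMap (Polynomial F) (RatFunc F) a

section Cumulant

open Finset

variable {α K : Type*} [DecidableEq α]

theorem mem_partitionsOf {s : Finset α} {π : Finset (Finset α)} :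
    π ∈ partitionsOf s ↔ (∀ B ∈ π, B.Nonempty) ∧
      (∀ B ∈ π, ∀ B' ∈ π, ∀ x ∈ B, x ∈ B' → B = B') ∧ ∀ x, x ∈ s ↔ ∃ B ∈ π, x ∈ B := by
  have hsup : π.sup id = s ↔ ∀ x, x ∈ s ↔ ∃ B ∈ π, x ∈ B := by
    simp only [Finset.ext_iff, Finset.mem_sup, id]
    exact forall_congr' fun x => Iff.comm
  have hdisj : (∀ B ∈ π, ∀ B' ∈ π, B ≠ B' → B ∩ B' = ∅) ↔
      ∀ B ∈ π, ∀ B' ∈ π, ∀ x ∈ B, x ∈ B' → B = B' := by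
    refine forall₄_congr fun B _ B' _ => ?_
    simp only [Finset.eq_empty_iff_forall_notMem, Finset.mem_inter]
    grind
  simp only [partitionsOf, mem_filter, mem_powerset, hsup, hdisj, ← nonempty_iff_ne_empty]
  refine ⟨fun h => h.2, fun h => ⟨fun B hB => mem_powerset.2 fun x hx => ?_, h⟩⟩
  exact (h.2.2 x).2 ⟨B, hB, hx⟩

theorem prod_prod_of_mem_partitionsOf {M : Type*} [CommMonoid M] {s : Finset α}
    {π : Finset (Finset α)} (hπ : π ∈ partitionsOf s) (w : α → M) :
    ∏ B ∈ π, ∏ i ∈ B, w i = ∏ i ∈ s, w i := by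
  rw [mem_partitionsOf] at hπ
  have hs : s = π.biUnion id := by
    ext x
    simpa using hπ.2.2 x
  rw [hs, prod_biUnion]
  · rfl
  · intro B hB B' hB' hne
    refine disjoint_left.2 fun x hx hx' => hne (hπ.2.1 B hB B' hB' x hx hx')

theorem cumulant_div_prod [Field K] (u : Finset α → K) (w : α → K) (H : Finset α) :
    cumulant (fun I => u I / ∏ i ∈ I, w i) H = cumulant u H / ∏ i ∈ H, w i := by
  simp only [cumulant, sum_div]
  refine sum_congr rfl fun π hπ => ?_
  rw [prod_div_distrib, prod_prod_of_mem_partitionsOf hπ, smul_div_assoc]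

theorem card_filter_notMem_of_mem_partitionsOf {s : Finset α} {π : Finset (Finset α)}
    (hπ : π ∈ partitionsOf s) {h : α} (hs : h ∈ s) :
    #{C ∈ π | h ∉ C} = #π - 1 := by
  rw [mem_partitionsOf] at hπ
  obtain ⟨B, hB, hhB⟩ := (hπ.2.2 h).1 hs
  have : {C ∈ π | h ∉ C} = π.erase B := by
    ext C
    grind
  rw [this, card_erase_of_mem hB]

theorem subset_of_mem_partitionsOf_insert {h : α} {X C : Finset α} {σ : Finset (Finset α)}
    (hσ : σ ∈ partitionsOf (insert h X)) (hC : C ∈ σ) (hhC : h ∉ C) : C ⊆ X := by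
  rw [mem_partitionsOf] at hσ
  intro x hx
  exact mem_of_mem_insert_of_ne ((hσ.2.2 x).2 ⟨C, hC, hx⟩) fun h' => hhC (h' ▸ hx)

theorem sdiff_notMem {h : α} {X A : Finset α} {π : Finset (Finset α)} (hX : h ∉ X)
    (hA : A ⊂ X) (hπ : π ∈ partitionsOf (insert h A)) : X \ A ∉ π := by
  rw [mem_partitionsOf] at hπ
  intro hmem
  obtain ⟨x, hxX, hxA⟩ := exists_of_ssubset hA
  have := (hπ.2.2 x).2 ⟨_, hmem, mem_sdiff.2 ⟨hxX, hxA⟩⟩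
  grind

theorem insert_sdiff_mem_partitionsOf {h : α} {X A : Finset α} {π : Finset (Finset α)}
    (hX : h ∉ X) (hA : A ⊂ X) (hπ : π ∈ partitionsOf (insert h A)) :
    insert (X \ A) π ∈ partitionsOf (insert h X) := by
  rw [mem_partitionsOf] at hπ ⊢
  obtain ⟨h1, h2, h3⟩ := hπ
  have hne : (X \ A).Nonempty := sdiff_nonempty.2 hA.not_subset
  have hAX := hA.subset
  have hd : ∀ B ∈ π, ∀ x ∈ B, x ∉ X \ A := fun B hB x hx hx' => by
    have := (h3 x).2 ⟨B, hB, hx⟩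
    grind
  refine ⟨by grind, by grind, fun x => ?_⟩
  have := h3 x
  simp only [exists_mem_insert, ← this]
  grind

theorem erase_mem_partitionsOf {h : α} {X C : Finset α} {σ : Finset (Finset α)}
    (hσ : σ ∈ partitionsOf (insert h X)) (hC : C ∈ σ) (hhC : h ∉ C) :
    X \ C ⊂ X ∧ σ.erase C ∈ partitionsOf (insert h (X \ C)) := by
  have hCX := subset_of_mem_partitionsOf_insert hσ hC hhC
  rw [mem_partitionsOf] at hσ ⊢
  obtain ⟨h1, h2, h3⟩ := hσ
  refine ⟨sdiff_ssubset hCX (h1 C hC), by grind, by grind, fun x => ⟨fun hx => ?_, ?_⟩⟩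
  · obtain ⟨B, hB, hxB⟩ := (h3 x).1 (by grind)
    exact ⟨B, by grind, hxB⟩
  · rintro ⟨B, hB, hxB⟩
    have := (h3 x).2 ⟨B, by grind, hxB⟩
    grind

theorem sum_partitionsOf_insert_mul [CommRing K] (u : Finset α → K) {h : α} {X : Finset α}
    (hX : h ∉ X) :
    ∑ A ∈ X.ssubsets, cumulant u (insert h A) * u (X \ A) =
      ∑ σ ∈ partitionsOf (insert h X), ∑ C ∈ σ with h ∉ C,
        ((-1 : ℤ) ^ (#σ - 2) * (#σ - 2).factorial) • ∏ B ∈ σ, u B := by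
  simp only [cumulant, sum_mul]
  rw [sum_sigma', sum_sigma']
  refine sum_bij' (fun p _ => ⟨insert (X \ p.1) p.2, X \ p.1⟩)
    (fun p _ => ⟨X \ p.2, p.1.erase p.2⟩) ?_ ?_ ?_ ?_ ?_
  · rintro ⟨A, π⟩ hp
    simp only [mem_sigma, mem_ssubsets, mem_filter] at hp ⊢
    exact ⟨insert_sdiff_mem_partitionsOf hX hp.1 hp.2, mem_insert_self _ _, by simp [hX]⟩
  · rintro ⟨σ, C⟩ hp
    simp only [mem_sigma, mem_ssubsets, mem_filter] at hp ⊢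
    exact erase_mem_partitionsOf hp.1 hp.2.1 hp.2.2
  · rintro ⟨A, π⟩ hp
    simp only [mem_sigma, mem_ssubsets] at hp
    simp only [Finset.sdiff_sdiff_eq_self hp.1.subset, erase_insert (sdiff_notMem hX hp.1 hp.2)]
  · rintro ⟨σ, C⟩ hp
    simp only [mem_sigma, mem_filter] at hp
    have hC : C ⊆ X := subset_of_mem_partitionsOf_insert hp.1 hp.2.1 hp.2.2
    simp only [Finset.sdiff_sdiff_eq_self hC, insert_erase hp.2.1]
  · rintro ⟨A, π⟩ hp
    simp only [mem_sigma, mem_ssubsets] at hp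
    have hnot := sdiff_notMem hX hp.1 hp.2
    simp only [prod_insert hnot, card_insert_of_notMem hnot, smul_mul_assoc, mul_comm (u _)]
    rfl

theorem eq_sum_cumulant_mul [CommRing K] (u : Finset α → K) (hu : u ∅ = 1) {h : α}
    {X : Finset α} (hX : h ∉ X) :
    u (insert h X) = ∑ A ∈ X.powerset, cumulant u (insert h A) * u (X \ A) := by
  have hsplit : X.powerset = insert X X.ssubsets := by
    ext A
    simp only [mem_powerset, mem_insert, mem_ssubsets]
    exact le_iff_eq_or_lt
  rw [hsplit, sum_insert (by simp), sum_partitionsOf_insert_mul u hX, sdiff_self,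
    bot_eq_empty, hu, mul_one, cumulant, ← sum_add_distrib]
  have htop : {insert h X} ∈ partitionsOf (insert h X) := by
    simp [mem_partitionsOf]
  rw [sum_eq_single_of_mem _ htop]
  · simp [filter_singleton]
  · intro σ hσ hne
    rw [sum_const, card_filter_notMem_of_mem_partitionsOf hσ (mem_insert_self h X)]
    have hcard : 2 ≤ #σ := by
      rw [mem_partitionsOf] at hσ
      by_contra! hlt
      obtain ⟨B, hB, -⟩ := (hσ.2.2 h).1 (mem_insert_self h X)
      have h1 : #σ = 1 := by have := card_pos.2 ⟨B, hB⟩; omega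
      obtain ⟨C, rfl⟩ := card_eq_one.1 h1
      refine hne ?_
      congr 1
      ext x
      simpa using (hσ.2.2 x).symm
    obtain ⟨n, hn⟩ := Nat.exists_eq_add_of_le' hcard
    rw [hn, show n + 2 - 1 = n + 1 from rfl, Nat.add_sub_cancel, ← natCast_zsmul, smul_smul,
      ← add_smul]
    convert zero_smul ℤ _
    push_cast [Nat.factorial_succ, pow_succ]
    ring

end Cumulant

section Smooth

open Finset

variable {α K : Type*} [DecidableEq α] [Field K]

/-- A decreasing multiplicative filtration of a field by additive subgroups, such that elements
congruent to `1` modulo the first step have their inverse in the zeroth step. -/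
structure IsLocalFiltration (M : ℕ → AddSubgroup K) : Prop where
  one_mem : 1 ∈ M 0
  antitone : Antitone M
  mul_mem : ∀ {m n x y}, x ∈ M m → y ∈ M n → x * y ∈ M (m + n)
  inv_mem : ∀ {x}, x - 1 ∈ M 1 → x⁻¹ ∈ M 0

/-- `f` takes values in `M k` on the subsets of `X`, and each iterated finite difference of `f` in
the directions `h₁, …, hⱼ ∈ X` takes values in `M (k + j)`. -/
inductive IsSmooth (M : ℕ → AddSubgroup K) : Finset α → ℕ → (Finset α → K) → Prop
  | intro {X : Finset α} {k : ℕ} {f : Finset α → K} (mem : ∀ I ⊆ X, f I ∈ M k)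
      (diff : ∀ h ∈ X, IsSmooth M (X.erase h) (k + 1) fun I => f (insert h I) - f I) :
      IsSmooth M X k f

namespace IsSmooth

variable {M : ℕ → AddSubgroup K} {X Y : Finset α} {k l : ℕ} {f g : Finset α → K} {h : α}

theorem mem (hf : IsSmooth M X k f) {I : Finset α} (hI : I ⊆ X) : f I ∈ M k := by
  cases hf with | intro h1 h2 => exact h1 I hI

theorem diff (hf : IsSmooth M X k f) (hh : h ∈ X) :
    IsSmooth M (X.erase h) (k + 1) fun I => f (insert h I) - f I := by
  cases hf with | intro h1 h2 => exact h2 h hh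

theorem congr (hf : IsSmooth M X k f) (hfg : ∀ I ⊆ X, f I = g I) : IsSmooth M X k g := by
  induction hf generalizing g with
  | @intro X k f h1 h2 ih =>
    refine ⟨fun I hI => hfg I hI ▸ h1 I hI, fun h hh => ih h hh fun I hI => ?_⟩
    simp only [hfg _ (insert_subset hh (hI.trans (erase_subset _ _))),
      hfg _ (hI.trans (erase_subset _ _))]

theorem subset (hf : IsSmooth M X k f) (hY : Y ⊆ X) : IsSmooth M Y k f := by
  induction hf generalizing Y with
  | @intro X k f h1 h2 ih =>
    exact ⟨fun I hI => h1 I (hI.trans hY), fun h hh => ih h (hY hh) (erase_subset_erase h hY)⟩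

theorem anti (hM : IsLocalFiltration M) (hf : IsSmooth M X k f) (hl : l ≤ k) :
    IsSmooth M X l f := by
  induction hf generalizing l with
  | @intro X k f h1 h2 ih =>
    exact ⟨fun I hI => hM.antitone hl (h1 I hI), fun h hh => ih h hh (by omega)⟩

theorem zero : IsSmooth M X k (fun _ => 0) := by
  induction X using Finset.strongInduction generalizing k with
  | H X ih =>
    refine ⟨fun I _ => zero_mem _, fun h hh => ?_⟩
    simpa using ih _ (erase_ssubset hh)

theorem const {a : K} (ha : a ∈ M k) : IsSmooth M X k (fun _ => a) :=
  ⟨fun _ _ => ha, fun h hh => by simpa using zero⟩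

theorem add (hf : IsSmooth M X k f) (hg : IsSmooth M X k g) :
    IsSmooth M X k (fun I => f I + g I) := by
  induction hf generalizing g with
  | @intro X k f h1 h2 ih =>
    refine ⟨fun I hI => add_mem (h1 I hI) (hg.mem hI), fun h hh => ?_⟩
    exact (ih h hh (hg.diff hh)).congr fun I _ => by ring

theorem neg (hf : IsSmooth M X k f) : IsSmooth M X k (fun I => -f I) := by
  induction hf with
  | @intro X k f h1 h2 ih =>
    refine ⟨fun I hI => neg_mem (h1 I hI), fun h hh => ?_⟩
    exact (ih h hh).congr fun I _ => by ring

theorem shift (hM : IsLocalFiltration M) (hf : IsSmooth M X k f) (hh : h ∈ X) :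
    IsSmooth M (X.erase h) k (fun I => f (insert h I)) :=
  ((hf.subset (erase_subset h X)).add ((hf.diff hh).anti hM (Nat.le_succ k))).congr
    fun I _ => by ring

theorem shift_union (hM : IsLocalFiltration M) (hf : IsSmooth M X k f) {A : Finset α}
    (hA : A ⊆ X) : IsSmooth M (X \ A) k (fun I => f (I ∪ A)) := by
  induction A using Finset.induction_on with
  | empty => simpa using hf
  | insert a A ha ih =>
    obtain ⟨haX, hAX⟩ := insert_subset_iff.1 hA
    have := (ih hAX).shift hM (mem_sdiff.2 ⟨haX, ha⟩)
    rw [← sdiff_insert] at this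
    simpa only [union_insert, insert_union] using this

theorem mul (hM : IsLocalFiltration M) (hf : IsSmooth M X k f) (hg : IsSmooth M X l g) :
    IsSmooth M X (k + l) (fun I => f I * g I) := by
  induction X using Finset.strongInduction generalizing k l f g with
  | H X ih =>
    refine ⟨fun I hI => hM.mul_mem (hf.mem hI) (hg.mem hI), fun h hh => ?_⟩
    have h1 := ih _ (erase_ssubset hh) (hf.diff hh) (hg.shift hM hh)
    have h2 := ih _ (erase_ssubset hh) (hf.subset (erase_subset h X)) (hg.diff hh)
    rw [show k + 1 + l = k + l + 1 by ring] at h1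
    exact (h1.add h2).congr fun I _ => by ring

theorem inv (hM : IsLocalFiltration M) (hf : IsSmooth M X 0 f) (h0 : ∀ I ⊆ X, f I ≠ 0)
    (hinv : ∀ I ⊆ X, (f I)⁻¹ ∈ M 0) : IsSmooth M X 0 (fun I => (f I)⁻¹) := by
  induction X using Finset.strongInduction generalizing f with
  | H X ih =>
    refine ⟨hinv, fun h hh => ?_⟩
    have hsub : X.erase h ⊆ X := erase_subset h X
    have hins : ∀ I ⊆ X.erase h, insert h I ⊆ X := fun I hI =>
      insert_subset hh (hI.trans hsub)
    have h1 := ih _ (erase_ssubset hh) (hf.subset hsub) (fun I hI => h0 I (hI.trans hsub))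
      fun I hI => hinv I (hI.trans hsub)
    have h2 := ih _ (erase_ssubset hh) (hf.shift hM hh) (fun I hI => h0 _ (hins I hI))
      fun I hI => hinv _ (hins I hI)
    refine (((hf.diff hh).mul hM h1).mul hM h2).neg.congr fun I hI => ?_
    have := h0 I (hI.trans hsub)
    have := h0 _ (hins I hI)
    field_simp
    ring

theorem sub_apply_empty_mem (hf : IsSmooth M X k f) {I : Finset α}
    (hI : I ⊆ X) : f I - f ∅ ∈ M (k + 1) := by
  induction I using Finset.induction_on with
  | empty => simp
  | insert h I hh ih =>
    obtain ⟨hX, hIX⟩ := insert_subset_iff.1 hI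
    have := add_mem ((hf.diff hX).mem (subset_erase.2 ⟨hIX, hh⟩)) (ih hIX)
    simpa using this

theorem apply_mem_of_forall_ssubset (hf : IsSmooth M X k f) (h0 : ∀ I ⊂ X, f I = 0) :
    f X ∈ M (k + #X) := by
  induction hf with
  | @intro X k f h1 h2 ih =>
    obtain rfl | ⟨h, hh⟩ := X.eq_empty_or_nonempty
    · exact h1 _ subset_rfl
    · have := ih h hh fun I hI => ?_
      · simp only [insert_erase hh] at this
        rw [h0 _ (erase_ssubset hh), sub_zero, card_erase_of_mem hh] at this
        have hpos := card_pos.2 ⟨h, hh⟩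
        rwa [show k + 1 + (#X - 1) = k + #X by omega] at this
      · have hIX : I ⊂ X := hI.trans (erase_ssubset hh)
        simp only [h0 I hIX, sub_zero]
        refine h0 _ ?_
        refine (insert_subset hh hIX.subset).ssubset_of_ne fun h' => hI.ne ?_
        rw [← h', erase_insert fun hhI => by simpa using hI.subset hhI]

theorem sum_powerset_sdiff {G : Finset α → Finset α → K}
    (hM : IsLocalFiltration M) (hG : ∀ A ⊆ X, IsSmooth M (X \ A) (k + #A) (G A)) :
    IsSmooth M X k (fun I => ∑ A ∈ I.powerset, G A (I \ A)) := by
  induction X using Finset.strongInduction generalizing k G with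
  | H X ih =>
    refine ⟨fun I hI => sum_mem fun A hA => ?_, fun h hh => ?_⟩
    · have hA := mem_powerset.1 hA
      exact hM.antitone (Nat.le_add_right _ _)
        ((hG A (hA.trans hI)).mem (sdiff_subset_sdiff hI subset_rfl))
    · have key := ih (X.erase h) (erase_ssubset hh) (k := k + 1)
        (G := fun A I => (G A (insert h I) - G A I) + G (insert h A) I) fun A hA => ?_
      · refine key.congr fun I hI => ?_
        have hhI : h ∉ I := fun hhI => by simpa using hI hhI
        rw [sum_powerset_insert hhI, sum_add_distrib, sum_sub_distrib, add_sub_right_comm]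
        congr 1
        · congr 1
          refine sum_congr rfl fun A hA => ?_
          rw [insert_sdiff_of_notMem _ fun h' => hhI (mem_powerset.1 hA h')]
        · refine sum_congr rfl fun A hA => ?_
          rw [insert_sdiff_insert, sdiff_insert_of_notMem hhI]
      · have hhA : h ∉ A := fun h' => by simpa using hA h'
        have hAX : A ⊆ X := hA.trans (erase_subset _ _)
        have h1 := (hG A hAX).diff (mem_sdiff.2 ⟨hh, hhA⟩)
        have h2 := hG (insert h A) (insert_subset hh hAX)
        rw [card_insert_of_notMem hhA] at h2
        rw [← erase_sdiff_comm, show k + #A + 1 = k + 1 + #A by ring] at h1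
        rw [sdiff_insert, ← erase_sdiff_comm, show k + (#A + 1) = k + 1 + #A by ring] at h2
        exact h1.add h2

end IsSmooth

/-- The successive ratios of the family `u` are smooth functions. -/
def HasSmoothRatio (M : ℕ → AddSubgroup K) (u : Finset α → K) (X : Finset α) : Prop :=
  ∀ h ∉ X, IsSmooth M X 0 (fun I => u (insert h I) / u I)

variable {M : ℕ → AddSubgroup K} {X : Finset α} {u v : Finset α → K}

theorem HasSmoothRatio.inv_ratio (hM : IsLocalFiltration M) (hX : HasSmoothRatio M u X)
    (hu : ∀ I, u I ≠ 0) (h0 : u ∅ = 1) (h1 : ∀ i, u {i} = 1) {h : α} (hh : h ∉ X) :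
    IsSmooth M X 0 (fun I => u I / u (insert h I)) := by
  have := (hX h hh).inv hM (fun I _ => div_ne_zero (hu _) (hu _)) fun I hI => hM.inv_mem ?_
  · simpa using this
  · simpa [h0, h1] using (hX h hh).sub_apply_empty_mem hI

theorem isSmooth_div_union (hM : IsLocalFiltration M) (hu : ∀ I, u I ≠ 0) (h0 : u ∅ = 1)
    (h1 : ∀ i, u {i} = 1) (hX : ∀ Y ⊂ X, HasSmoothRatio M u Y) {A : Finset α} (hA : A ⊆ X) :
    IsSmooth M (X \ A) 0 (fun I => u I / u (I ∪ A)) := by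
  induction A using Finset.induction_on with
  | empty => simpa [hu] using IsSmooth.const hM.one_mem
  | insert a A ha ih =>
    obtain ⟨haX, hAX⟩ := insert_subset_iff.1 hA
    have key := (hX _ (erase_ssubset haX)).inv_ratio hM hu h0 h1 (notMem_erase a X)
    have key := key.shift_union hM (subset_erase.2 ⟨hAX, ha⟩)
    rw [erase_sdiff_comm, ← sdiff_insert] at key
    refine (((ih hAX).subset (sdiff_subset_sdiff subset_rfl (subset_insert a A))).mul hM
      key).congr fun I _ => ?_
    simp only [union_insert]
    exact div_mul_div_cancel₀ (hu _)

theorem ratio_eq_sum_cumulant (h0 : u ∅ = 1) {h : α} {I : Finset α}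
    (hI : h ∉ I) : u (insert h I) / u I =
      ∑ A ∈ I.powerset, cumulant u (insert h A) * (u (I \ A) / u (I \ A ∪ A)) := by
  rw [eq_sum_cumulant_mul u h0 hI, sum_div]
  refine sum_congr rfl fun A hA => ?_
  rw [sdiff_union_of_subset (mem_powerset.1 hA), mul_div_assoc]

theorem hasSmoothRatio_of_cumulant_mem (hM : IsLocalFiltration M) (hu : ∀ I, u I ≠ 0)
    (h0 : u ∅ = 1) (h1 : ∀ i, u {i} = 1)
    (hc : ∀ h A, h ∉ A → cumulant u (insert h A) ∈ M #A) : HasSmoothRatio M u X := by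
  induction X using Finset.strongInduction with
  | H X ih =>
    intro h hh
    have key : IsSmooth M X 0 (fun I => ∑ A ∈ I.powerset,
        cumulant u (insert h A) * (u (I \ A) / u (I \ A ∪ A))) := by
      refine IsSmooth.sum_powerset_sdiff (k := 0)
        (G := fun A J => cumulant u (insert h A) * (u J / u (J ∪ A))) hM fun A hA => ?_
      have hg := isSmooth_div_union hM hu h0 h1 ih hA
      rw [zero_add]
      exact (IsSmooth.const (hc h A fun h' => hh (hA h'))).mul hM hg
    exact key.congr fun I hI => (ratio_eq_sum_cumulant h0 fun h' => hh (hI h')).symm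

theorem cumulant_mem_of_hasSmoothRatio (hM : IsLocalFiltration M) (hu : ∀ I, u I ≠ 0)
    (h0 : u ∅ = 1) (h1 : ∀ i, u {i} = 1) (hX : ∀ X, HasSmoothRatio M u X) {h : α}
    (hh : h ∉ X) : cumulant u (insert h X) ∈ M #X := by
  induction X using Finset.strongInduction with
  | H X ih =>
    have key : IsSmooth M X 0 (fun I => ∑ A ∈ I.powerset,
        if A = X then 0 else cumulant u (insert h A) * (u (I \ A) / u (I \ A ∪ A))) := by
      refine IsSmooth.sum_powerset_sdiff (k := 0) (G := fun A J => if A = X then 0 else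
        cumulant u (insert h A) * (u J / u (J ∪ A))) hM fun A hA => ?_
      split_ifs with hAX
      · exact IsSmooth.zero
      have hg := isSmooth_div_union hM hu h0 h1 (fun Y _ => hX Y) hA
      rw [zero_add]
      exact (IsSmooth.const (ih A (hA.ssubset_of_ne hAX) fun h' => hh (hA h'))).mul hM hg
    have hmem := ((hX X h hh).add key.neg).apply_mem_of_forall_ssubset fun I hI => ?_
    · rw [ratio_eq_sum_cumulant h0 hh, ← sub_eq_add_neg, ← sum_sub_distrib,
        sum_eq_single_of_mem X (mem_powerset_self X) fun A _ hA => by simp [hA]] at hmem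
      have hu1 : u X ∈ M 0 := by
        refine X.induction_on (h0 ▸ hM.one_mem) fun a I ha hI => ?_
        have := hM.mul_mem ((hX I a ha).mem subset_rfl) hI
        rwa [div_mul_cancel₀ _ (hu I)] at this
      have := hM.mul_mem hmem hu1
      simpa [h0, hu X] using this
    · rw [ratio_eq_sum_cumulant h0 fun h' => hh (hI.subset h'), ← sub_eq_add_neg, sub_eq_zero]
      refine sum_congr rfl fun A hA => ?_
      rw [if_neg]
      rintro rfl
      exact hI.not_subset (mem_powerset.1 hA)

theorem HasSmoothRatio.mul (hM : IsLocalFiltration M) (hu : HasSmoothRatio M u X)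
    (hv : HasSmoothRatio M v X) : HasSmoothRatio M (fun I => u I * v I) X := fun h hh =>
  ((hu h hh).mul hM (hv h hh)).congr fun I _ => by simp only [div_mul_div_comm]

theorem HasSmoothRatio.div (hM : IsLocalFiltration M) (hu : HasSmoothRatio M u X)
    (hv : HasSmoothRatio M v X) (hv' : ∀ I, v I ≠ 0) (h0 : v ∅ = 1) (h1 : ∀ i, v {i} = 1) :
    HasSmoothRatio M (fun I => u I / v I) X := fun h hh =>
  ((hu h hh).mul hM (hv.inv_ratio hM hv' h0 h1 hh)).congr fun I _ => by
    rw [div_mul_div_comm, div_div_div_eq, mul_comm (u I)]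

end Smooth

section RatFunc

variable {F : Type*} [Field F]

theorem algebraMap_X_sub_C (c : F) :
    algebraMap (Polynomial F) (RatFunc F) (Polynomial.X - Polynomial.C c) =
      RatFunc.X - RatFunc.C c := by
  simp

/-- The filtration of `F(q)` by the order of vanishing at `q = c`. -/
def vanishingFiltration (c : F) (n : ℕ) : AddSubgroup (RatFunc F) where
  carrier := {f | IsOAt c f ((RatFunc.X - RatFunc.C c) ^ n)}
  zero_mem' := ⟨0, 1, by simp, by simp⟩
  add_mem' := by
    rintro f g ⟨a, b, hb, h⟩ ⟨a', b', hb', h'⟩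
    refine ⟨a * b' + a' * b, b * b', by simp [hb, hb'], ?_⟩
    simp only [map_add, map_mul]
    linear_combination algebraMap (Polynomial F) (RatFunc F) b' * h +
      algebraMap (Polynomial F) (RatFunc F) b * h'
  neg_mem' := by
    rintro f ⟨a, b, hb, h⟩
    refine ⟨-a, b, hb, ?_⟩
    rw [map_neg]
    linear_combination -h

theorem mem_vanishingFiltration {c : F} {n : ℕ} {f : RatFunc F} :
    f ∈ vanishingFiltration c n ↔ IsOAt c f ((RatFunc.X - RatFunc.C c) ^ n) :=
  Iff.rfl

theorem isLocalFiltration_vanishingFiltration (c : F) :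
    IsLocalFiltration (vanishingFiltration c) where
  one_mem := ⟨1, 1, by simp, by simp⟩
  antitone := by
    rintro m n hmn f ⟨a, b, hb, h⟩
    obtain ⟨k, rfl⟩ := Nat.exists_eq_add_of_le hmn
    refine ⟨(Polynomial.X - Polynomial.C c) ^ k * a, b, hb, ?_⟩
    rw [h, map_mul, map_pow, algebraMap_X_sub_C]
    ring
  mul_mem := by
    rintro m n f g ⟨a, b, hb, h⟩ ⟨a', b', hb', h'⟩
    refine ⟨a * a', b * b', by simp [hb, hb'], ?_⟩
    simp only [map_mul]
    rw [mul_mul_mul_comm, h, h']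
    ring
  inv_mem := by
    rintro x ⟨a, b, hb, h⟩
    have hd : Polynomial.eval c (b + (Polynomial.X - Polynomial.C c) * a) ≠ 0 := by simpa using hb
    have hx : x * algebraMap (Polynomial F) (RatFunc F) b =
        algebraMap (Polynomial F) (RatFunc F) (b + (Polynomial.X - Polynomial.C c) * a) := by
      rw [map_add, map_mul, algebraMap_X_sub_C]
      linear_combination h
    have hx0 : x ≠ 0 := by
      rintro rfl
      rw [zero_mul, eq_comm, FaithfulSMul.algebraMap_eq_zero_iff] at hx
      simp [hx] at hd
    refine ⟨b, _, hd, ?_⟩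
    rw [← hx, inv_mul_cancel_left₀ hx0, pow_zero, one_mul]

theorem small_cumulants_iff_hasSmoothRatio {α : Type*} [DecidableEq α] (c : F)
    {u : Finset α → RatFunc F} (hu : ∀ I, u I ≠ 0) (h0 : u ∅ = 1) :
    (∀ H : Finset α, 2 ≤ H.card → IsOAt c (cumulant u H / ∏ h ∈ H, u {h})
        ((RatFunc.X - RatFunc.C c) ^ (H.card - 1))) ↔
      ∀ X, HasSmoothRatio (vanishingFiltration c) (fun I => u I / ∏ i ∈ I, u {i}) X := by
  have hM := isLocalFiltration_vanishingFiltration c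
  have hp (I : Finset α) : ∏ i ∈ I, u {i} ≠ 0 := Finset.prod_ne_zero_iff.2 fun i _ => hu {i}
  have hU (I : Finset α) : u I / ∏ i ∈ I, u {i} ≠ 0 := div_ne_zero (hu I) (hp I)
  have hU0 : u ∅ / ∏ i ∈ ∅, u {i} = 1 := by simp [h0]
  have hU1 (i : α) : u {i} / ∏ j ∈ {i}, u {j} = 1 := by simp [hu]
  constructor
  · intro hc X
    refine hasSmoothRatio_of_cumulant_mem hM hU hU0 hU1 fun h A hA => ?_
    rw [cumulant_div_prod, mem_vanishingFiltration]
    obtain rfl | hne := A.eq_empty_or_nonempty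
    · have := eq_sum_cumulant_mul u h0 (Finset.notMem_empty h)
      simp only [Finset.powerset_empty, Finset.sum_singleton, Finset.sdiff_self, h0,
        mul_one, insert_empty_eq] at this
      simpa [← this, hu, mem_vanishingFiltration] using hM.one_mem
    · have hcard := hc (insert h A)
      rw [Finset.card_insert_of_notMem hA] at hcard
      exact hcard (by have := hne.card_pos; omega)
  · intro hX H hH
    obtain ⟨h, hh⟩ := Finset.card_pos.1 (by omega : 0 < H.card)
    have := cumulant_mem_of_hasSmoothRatio hM hU hU0 hU1 hX (Finset.notMem_erase h H)
    rwa [Finset.insert_erase hh, cumulant_div_prod, Finset.card_erase_of_mem hh] at this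

end RatFunc


/-- if the families `(u_I)` and `(v_I)` of nonzero rational functions with
`u_∅ = v_∅ = 1` both have the small cumulant property at `q = c`, then so do their
entry-wise product and entry-wise quotient. -/
theorem small_cumulants_stable_product_quotient {F : Type*} [Field F] (c : F)
    (r : ℕ) (hr : 0 < r) (u v : Finset (Fin r) → RatFunc F)
    (hu : ∀ I, u I ≠ 0) (hv : ∀ I, v I ≠ 0) (hu0 : u ∅ = 1) (hv0 : v ∅ = 1)
    (hcu : ∀ H : Finset (Fin r), 2 ≤ H.card →
      IsOAt c (cumulant u H / ∏ h ∈ H, u {h})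
        ((RatFunc.X - RatFunc.C c) ^ (H.card - 1)))
    (hcv : ∀ H : Finset (Fin r), 2 ≤ H.card →
      IsOAt c (cumulant v H / ∏ h ∈ H, v {h})
        ((RatFunc.X - RatFunc.C c) ^ (H.card - 1))) :
    (∀ H : Finset (Fin r), 2 ≤ H.card →
      IsOAt c (cumulant (fun I => u I * v I) H / ∏ h ∈ H, (u {h} * v {h}))
        ((RatFunc.X - RatFunc.C c) ^ (H.card - 1))) ∧
    (∀ H : Finset (Fin r), 2 ≤ H.card →
      IsOAt c (cumulant (fun I => u I / v I) H / ∏ h ∈ H, (u {h} / v {h}))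
        ((RatFunc.X - RatFunc.C c) ^ (H.card - 1))) := by
  have hM := isLocalFiltration_vanishingFiltration c
  rw [small_cumulants_iff_hasSmoothRatio c hu hu0] at hcu
  rw [small_cumulants_iff_hasSmoothRatio c hv hv0] at hcv
  constructor
  · rw [small_cumulants_iff_hasSmoothRatio c (u := fun I => u I * v I)
      (fun I => mul_ne_zero (hu I) (hv I)) (by simp [hu0, hv0])]
    intro X
    simpa only [Finset.prod_mul_distrib, div_mul_div_comm] using (hcu X).mul hM (hcv X)
  · rw [small_cumulants_iff_hasSmoothRatio c (u := fun I => u I / v I)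
      (fun I => div_ne_zero (hu I) (hv I)) (by simp [hu0, hv0])]
    intro X
    have hp (I : Finset (Fin r)) : ∏ i ∈ I, v {i} ≠ 0 :=
      Finset.prod_ne_zero_iff.2 fun i _ => hv {i}
    have := (hcu X).div hM (hcv X) (fun I => div_ne_zero (hv I) (hp I)) (by simp [hv0])
      (by simp [hv])
    simpa only [Finset.prod_div_distrib, div_div_div_comm] using this
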